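/- Von Staudt–Clausen: for an even positive integer 2m, the denominator of the Bernoulli number B_{2m} is the product of all primes p such that (p−1) divides 2m; in particular B_{2m} + Σ_{(p−1) | 2m} 1/p is an integer. -/

import Mathlib

theorem Rat.den_dvd_add_den_of_coprime {a b : ℚ} (h : a.den.Coprime b.den) :
    a.den ∣ (a + b).den := by
  have hd := Rat.add_den_dvd (a + b) (-b)
  rw [add_neg_cancel_right, Rat.neg_den] at hd
  exact h.dvd_of_dvd_mul_right hd

theorem Rat.add_den_of_coprime {a b : ℚ} (h : a.den.Coprime b.den) :
    (a + b).den = a.den * b.den :=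
  Nat.dvd_antisymm (Rat.add_den_dvd a b) <|
    h.mul_dvd_of_dvd_of_dvd (Rat.den_dvd_add_den_of_coprime h)
      (add_comm a b ▸ Rat.den_dvd_add_den_of_coprime h.symm)

theorem Rat.den_sum_one_div_primes (s : Finset ℕ) (hs : ∀ p ∈ s, p.Prime) :
    (∑ p ∈ s, (1 : ℚ) / p).den = ∏ p ∈ s, p := by
  induction s using Finset.induction_on with
  | empty => simp
  | insert q s hq ih =>
    have hqp : q.Prime := hs q (Finset.mem_insert_self q s)
    have hsp : ∀ p ∈ s, p.Prime := fun p hp => hs p (Finset.mem_insert_of_mem hp)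
    have hden : ((1 : ℚ) / q).den = q := by simp [hqp.ne_zero]
    rw [Finset.sum_insert hq, Finset.prod_insert hq, Rat.add_den_of_coprime, hden, ih hsp]
    rw [hden, ih hsp]
    exact Nat.Coprime.prod_right fun p hp =>
      (Nat.coprime_primes hqp (hsp p hp)).mpr fun h => hq (h ▸ hp)


/-- Von Staudt–Clausen: for an even positive integer `2m`, the denominator of the
Bernoulli number `B_{2m}` is the product of all primes `p` with `(p−1) ∣ 2m`
(all such primes satisfy `p ≤ 2m + 1`); in particular `B_{2m} + ∑_{(p−1)∣2m} 1/p`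
is an integer. -/
theorem von_staudt_clausen (m : ℕ) (hm : 0 < m) :
    (bernoulli (2 * m)).den =
      ∏ p ∈ (Finset.range (2 * m + 2)).filter (fun p => p.Prime ∧ (p - 1) ∣ 2 * m), p ∧
    ∃ z : ℤ,
      bernoulli (2 * m) +
        ∑ p ∈ (Finset.range (2 * m + 2)).filter (fun p => p.Prime ∧ (p - 1) ∣ 2 * m),
          (1 : ℚ) / p = (z : ℚ) := by
  obtain ⟨z, hz⟩ := Bernoulli.vonStaudt_clausen m
  refine ⟨?_, z, hz.symm⟩
  rw [eq_sub_of_add_eq hz.symm, sub_eq_add_neg, Rat.intCast_add_den, Rat.neg_den,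
    Rat.den_sum_one_div_primes _ fun p hp => (Finset.mem_filter.mp hp).2.1]
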